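/- arXiv:1210.2081 — 3 statements merged into one kernel-verified Lean document; each statement's English description precedes it below -/
import Mathlib

section
/- Let m ≥ 2 be an integer and z₁, …, z_m > 0. For i = 1, …, m let μᵢ be the probability measure on ℝ with density g₊(·; zᵢ) on (0, ∞) (and zero elsewhere), let μ be the probability measure with density g₊(·; z₁ + ⋯ + z_m) on (0, ∞), and let γ be the Gamma distribution with shape parameter (m-1)/2 and rate 1/2 (scale 2). Then the m-fold convolution μ₁ ∗ μ₂ ∗ ⋯ ∗ μ_m equals the convolution μ ∗ γ; equivalently, the pushforward of the product measure μ₁ ⊗ ⋯ ⊗ μ_m under the sum map (x₁, …, x_m) ↦ x₁ + ⋯ + x_m equals μ ∗ γ. -/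
open MeasureTheory

/-- The generalized inverse Gaussian density with parameters `(ψ, χ, λ) = (1, z², +1/2)`:
`g₊(x; z) = (e^z / √(2π)) x^{-1/2} exp(-z²/(2x) - x/2)`. -/
noncomputable def gigPlus (z x : ℝ) : ℝ :=
  Real.exp z / Real.sqrt (2 * Real.pi) * x ^ (-(1 : ℝ) / 2) *
    Real.exp (-z ^ 2 / (2 * x) - x / 2)

/-- The probability measure on `ℝ` with density `g₊(·; z)` on `(0, ∞)` and zero elsewhere. -/
noncomputable def gigMeasure (z : ℝ) : Measure ℝ :=
  volume.withDensity fun x => ENNReal.ofReal (if 0 < x then gigPlus z x else 0)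

/-- The Gamma distribution with shape `a` and rate `r`, with density
`(r^a / Γ(a)) x^{a-1} e^{-rx}` on `(0, ∞)`. -/
noncomputable def gammaMeasure (a r : ℝ) : Measure ℝ :=
  volume.withDensity fun x =>
    ENNReal.ofReal (if 0 < x then r ^ a / Real.Gamma a * x ^ (a - 1) * Real.exp (-r * x) else 0)

/-- A substitution of Cauchy-Schlömilch type. -/
lemma integral_rpow_neg_half_mul_comp_mul_sqrt_sub_div_sqrt {a z : ℝ} (ha : 0 < a) (hz : 0 < z)
    {f : ℝ → ℝ} (hf : Integrable f) (heven : ∀ v, f (-v) = f v) :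
    IntegrableOn (fun x => x ^ (-(1 : ℝ) / 2) * f (a * √x - z / √x)) (Set.Ioi 0) ∧
      ∫ x in Set.Ioi 0, x ^ (-(1 : ℝ) / 2) * f (a * √x - z / √x) = (∫ v, f v) / a := by
  let R : ℝ → ℝ := fun v => √(v ^ 2 + 4 * a * z)
  let u : ℝ → ℝ := fun v => (v + R v) / (2 * a)
  have haz : 0 < a * z := mul_pos ha hz
  have hpos (v : ℝ) : 0 < v ^ 2 + 4 * a * z := by nlinarith [sq_nonneg v]
  have hR (v : ℝ) : 0 < R v := Real.sqrt_pos.2 (hpos v)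
  have hRsq (v : ℝ) : R v ^ 2 = v ^ 2 + 4 * a * z := Real.sq_sqrt (hpos v).le
  have habs (v : ℝ) : |v| < R v := by
    apply abs_lt_of_sq_lt_sq _ (hR v).le
    rw [hRsq]; nlinarith
  have hu (v : ℝ) : 0 < u v := div_pos (by linarith [neg_abs_le v, habs v]) (by linarith)
  have hinv (v : ℝ) : a * u v - z / u v = v := by
    have h1 : u v * (2 * a) = v + R v := div_mul_cancel₀ _ (by positivity)
    have h2 := hu v
    field_simp
    have : a * (a * u v ^ 2 - z - u v * v) = 0 := by
      have h3 : (u v * (2 * a) - v) ^ 2 = v ^ 2 + 4 * a * z := by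
        rw [h1, ← hRsq]; ring
      nlinarith
    have := (mul_eq_zero.1 this).resolve_left ha.ne'
    linarith
  have hderiv (v : ℝ) (_ : v ∈ Set.univ) : HasDerivWithinAt (fun v => u v ^ 2)
      (u v * ((1 + v / R v) / a)) Set.univ v := by
    have h1 : HasDerivAt R (v / R v) v := by
      convert! (((hasDerivAt_id v).pow 2).add_const (4 * a * z)).sqrt (hpos v).ne' using 1
      simp [R]
      field_simp
    have h2 := (((hasDerivAt_id v).add h1).div_const (2 * a)).pow 2
    refine HasDerivAt.hasDerivWithinAt ?_
    convert! h2 using 1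
    simp [u]
    field_simp
  have hinj : Set.InjOn (fun v => u v ^ 2) Set.univ := by
    intro v _ w _ h
    have : u v = u w := (pow_left_inj₀ (hu v).le (hu w).le two_ne_zero).1 h
    rw [← hinv v, ← hinv w, this]
  have himage : (fun v => u v ^ 2) '' Set.univ = Set.Ioi 0 := by
    ext x
    simp only [Set.image_univ, Set.mem_range, Set.mem_Ioi]
    refine ⟨fun ⟨v, hv⟩ => hv ▸ pow_pos (hu v) 2, fun hx => ?_⟩
    have hs : 0 < √x := Real.sqrt_pos.2 hx
    refine ⟨a * √x - z / √x, ?_⟩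
    have : R (a * √x - z / √x) = a * √x + z / √x := by
      refine (Real.sqrt_eq_iff_mul_self_eq_of_pos (by positivity)).2 ?_
      field_simp
      ring
    simp only [u, this]
    rw [show (a * √x - z / √x + (a * √x + z / √x)) / (2 * a) = √x by field_simp; ring,
      Real.sq_sqrt hx.le]
  have hweight (v : ℝ) : 0 < 1 + v / R v := by
    have : (R v + v) / R v = 1 + v / R v := by rw [add_div, div_self (hR v).ne']
    rw [← this]
    exact div_pos (by linarith [neg_abs_le v, habs v]) (hR v)
  have hsubst (v : ℝ) : |u v * ((1 + v / R v) / a)| •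
      ((u v ^ 2) ^ (-(1 : ℝ) / 2) * f (a * √(u v ^ 2) - z / √(u v ^ 2))) =
      f v / a + v / R v * f v / a := by
    have h1 : (u v ^ 2) ^ (-(1 : ℝ) / 2) = (u v)⁻¹ := by
      rw [← Real.rpow_natCast, ← Real.rpow_mul (hu v).le, ← Real.rpow_neg_one]
      norm_num
    rw [Real.sqrt_sq (hu v).le, hinv, h1, smul_eq_mul,
      abs_of_pos (mul_pos (hu v) (div_pos (hweight v) ha))]
    have := hu v
    field_simp
  have hodd : Integrable (fun v => v / R v * f v / a) := by
    refine (hf.bdd_mul (c := 1) (f := fun v => v / R v) ?_ ?_).div_const a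
    · refine Measurable.aestronglyMeasurable ?_
      fun_prop
    · refine Filter.Eventually.of_forall fun v => ?_
      rw [norm_div, Real.norm_eq_abs, Real.norm_of_nonneg (hR v).le, div_le_one (hR v)]
      exact (habs v).le
  have hodd_zero : ∫ v, v / R v * f v / a = 0 := by
    have h := integral_neg_eq_self (fun v => v / R v * f v / a) volume
    have h2 (v : ℝ) : -v / R (-v) * f (-v) / a = -(v / R v * f v / a) := by
      rw [heven]; simp only [R, neg_sq]; ring
    simp only [h2, integral_neg] at h
    linarith
  rw [← himage]
  constructor
  · rw [integrableOn_image_iff_integrableOn_abs_deriv_smul MeasurableSet.univ hderiv hinj]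
    simp only [hsubst, integrableOn_univ]
    exact (hf.div_const a).add hodd
  · rw [integral_image_eq_integral_abs_deriv_smul MeasurableSet.univ hderiv hinj]
    simp only [hsubst, setIntegral_univ]
    rw [integral_add (hf.div_const a) hodd, hodd_zero, integral_div, add_zero]

/-- Integrals against a measure on the positive half-line given by a density. -/
lemma integral_withDensity_posHalfLine {d : ℝ → ℝ} (hd : Measurable d)
    (hd0 : ∀ x, 0 < x → 0 ≤ d x) (f : ℝ → ℝ) :
    (Integrable f (volume.withDensity fun x => ENNReal.ofReal (if 0 < x then d x else 0)) ↔
      IntegrableOn (fun x => d x * f x) (Set.Ioi 0)) ∧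
    ∫ x, f x ∂(volume.withDensity fun x => ENNReal.ofReal (if 0 < x then d x else 0)) =
      ∫ x in Set.Ioi 0, d x * f x := by
  have hm : Measurable fun x : ℝ => ENNReal.ofReal (if 0 < x then d x else 0) :=
    (Measurable.ite measurableSet_Ioi hd measurable_const).ennreal_ofReal
  have heq : (fun x => (ENNReal.ofReal (if 0 < x then d x else 0)).toReal • f x) =
      (Set.Ioi 0).indicator fun x => d x * f x := by
    ext x
    by_cases hx : 0 < x
    · simp [hx, hd0 x hx]
    · simp [hx]
  constructor
  · rw [integrable_withDensity_iff_integrable_smul' hm (by simp), heq,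
      integrable_indicator_iff measurableSet_Ioi]
  · rw [integral_withDensity_eq_integral_toReal_smul hm (by simp), heq,
      integral_indicator measurableSet_Ioi]

lemma measurable_gigPlus (z : ℝ) : Measurable (gigPlus z) := by
  unfold gigPlus
  fun_prop

lemma mgf_gigMeasure {z t : ℝ} (hz : 0 < z) (ht : t < 1 / 2) :
    Integrable (fun x => Real.exp (t * x)) (gigMeasure z) ∧
      ProbabilityTheory.mgf id (gigMeasure z) t =
        Real.exp (z * (1 - √(1 - 2 * t))) / √(1 - 2 * t) := by
  set a := √(1 - 2 * t)
  have ha : 0 < a := Real.sqrt_pos.2 (by linarith)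
  have hasq : a ^ 2 = 1 - 2 * t := Real.sq_sqrt (by linarith)
  have hd0 (x : ℝ) (hx : 0 < x) : 0 ≤ gigPlus z x := by unfold gigPlus; positivity
  obtain ⟨hi, hv⟩ := integral_withDensity_posHalfLine (measurable_gigPlus z) hd0
    fun x => Real.exp (t * x)
  obtain ⟨hI, hV⟩ := integral_rpow_neg_half_mul_comp_mul_sqrt_sub_div_sqrt ha hz
    (integrable_exp_neg_mul_sq (b := 1 / 2) (by norm_num)) (by simp)
  have hcongr : Set.EqOn (fun x => gigPlus z x * Real.exp (t * x))
      (fun x => Real.exp (z * (1 - a)) / √(2 * Real.pi) * (x ^ (-(1 : ℝ) / 2) *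
        Real.exp (-(1 / 2) * (a * √x - z / √x) ^ 2))) (Set.Ioi 0) := by
    intro x (hx : 0 < x)
    have hs : 0 < √x := Real.sqrt_pos.2 hx
    have hexp : Real.exp z * (Real.exp (-z ^ 2 / (2 * x) - x / 2) * Real.exp (t * x)) =
        Real.exp (z * (1 - a)) * Real.exp (-(1 / 2) * (a * √x - z / √x) ^ 2) := by
      simp only [← Real.exp_add]
      congr 1
      have h1 : (a * √x - z / √x) ^ 2 = a ^ 2 * x - 2 * a * z + z ^ 2 / x := by
        have h2 : (√x)⁻¹ ^ 2 = x⁻¹ := by rw [inv_pow, Real.sq_sqrt hx.le]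
        have h3 : √x * (√x)⁻¹ = 1 := mul_inv_cancel₀ hs.ne'
        rw [div_eq_mul_inv, div_eq_mul_inv]
        linear_combination a ^ 2 * Real.sq_sqrt hx.le + z ^ 2 * h2 - 2 * a * z * h3
      rw [h1, hasq]
      field_simp
      ring
    simp only [gigPlus]
    linear_combination (1 / √(2 * Real.pi) * x ^ (-(1 : ℝ) / 2)) * hexp
  constructor
  · refine hi.2 (IntegrableOn.congr_fun ?_ hcongr.symm measurableSet_Ioi)
    exact hI.const_mul _
  · refine hv.trans ?_
    rw [setIntegral_congr_fun measurableSet_Ioi hcongr, integral_const_mul, hV,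
      integral_gaussian, show Real.pi / (1 / 2) = 2 * Real.pi by ring]
    field_simp

lemma mgf_gammaMeasure {α r t : ℝ} (hα : 0 < α) (hr : 0 < r) (ht : t < r) :
    Integrable (fun x => Real.exp (t * x)) (gammaMeasure α r) ∧
      ProbabilityTheory.mgf id (gammaMeasure α r) t = (r / (r - t)) ^ α := by
  have hrt : 0 < r - t := sub_pos.2 ht
  have hΓ := Real.Gamma_pos_of_pos hα
  obtain ⟨hi, hv⟩ := integral_withDensity_posHalfLine
    (d := fun x => r ^ α / Real.Gamma α * x ^ (α - 1) * Real.exp (-r * x)) (by fun_prop)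
    (fun x hx => by positivity) fun x => Real.exp (t * x)
  have hcongr : Set.EqOn
      (fun x => r ^ α / Real.Gamma α * x ^ (α - 1) * Real.exp (-r * x) * Real.exp (t * x))
      (fun x => r ^ α / Real.Gamma α * (x ^ (α - 1) * Real.exp (-((r - t) * x))))
      (Set.Ioi 0) := by
    intro x _
    simp only
    rw [mul_assoc _ (Real.exp _), ← Real.exp_add, mul_assoc]
    ring_nf
  constructor
  · refine hi.2 (IntegrableOn.congr_fun ?_ hcongr.symm measurableSet_Ioi)
    refine Integrable.const_mul ?_ _
    simpa only [IntegrableOn, Real.rpow_one, neg_mul] using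
      integrableOn_rpow_mul_exp_neg_mul_rpow (s := α - 1) (by linarith) one_pos hrt
  · refine hv.trans ?_
    rw [setIntegral_congr_fun measurableSet_Ioi hcongr, integral_const_mul,
      Real.integral_rpow_mul_exp_neg_mul_Ioi hα hrt, Real.div_rpow hr.le hrt.le,
      Real.div_rpow zero_le_one hrt.le, Real.one_rpow]
    field_simp

lemma isFiniteMeasure_gigMeasure {z : ℝ} (hz : 0 < z) : IsFiniteMeasure (gigMeasure z) := by
  have := (mgf_gigMeasure hz (t := 0) (by norm_num)).1
  simpa [integrable_const_iff] using this

lemma isFiniteMeasure_gammaMeasure {α r : ℝ} (hα : 0 < α) (hr : 0 < r) :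
    IsFiniteMeasure (gammaMeasure α r) := by
  have := (mgf_gammaMeasure hα hr hr).1
  simpa [integrable_const_iff] using this

lemma analyticOnNhd_complexMGF_id_of_integrable {μ : Measure ℝ} {b : ℝ}
    (h : ∀ t < b, Integrable (fun x => Real.exp (t * x)) μ) :
    AnalyticOnNhd ℂ (ProbabilityTheory.complexMGF id μ) {w | w.re < b} := by
  refine ProbabilityTheory.analyticOnNhd_complexMGF.mono fun w hw => ?_
  exact interior_maximal (fun t ht => h t ht) isOpen_Iio hw

/-- Functions analytic on a left half-plane that agree on its real points agree everywhere on it. -/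
lemma eqOn_re_lt_of_eq_ofReal {F G : ℂ → ℂ} {b : ℝ} (hF : AnalyticOnNhd ℂ F {w | w.re < b})
    (hG : AnalyticOnNhd ℂ G {w | w.re < b}) (h : ∀ t : ℝ, t < b → F t = G t) :
    Set.EqOn F G {w | w.re < b} := by
  refine AnalyticOnNhd.eqOn_of_preconnected_of_frequently_eq hF hG
    (convex_halfSpace_re_lt b).isPreconnected (z₀ := ((b - 1 : ℝ) : ℂ)) (by simp) ?_
  have hreal : ∃ᶠ t : ℝ in nhdsWithin (b - 1) {b - 1}ᶜ, F t = G t := by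
    refine Filter.Eventually.frequently ?_
    filter_upwards [mem_nhdsWithin_of_mem_nhds (Iio_mem_nhds (sub_one_lt b))] with t ht
    exact h t ht
  refine Filter.Tendsto.frequently ?_ hreal
  refine tendsto_nhdsWithin_iff.2 ⟨?_, ?_⟩
  · exact (Complex.continuous_ofReal.tendsto _).mono_left nhdsWithin_le_nhds
  · filter_upwards [self_mem_nhdsWithin] with t ht
    simpa [← Complex.ofReal_one, ← Complex.ofReal_sub] using ht

lemma charFun_map_sum_pi {ι : Type*} [Fintype ι] (μ : ι → Measure ℝ) [∀ i, SigmaFinite (μ i)]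
    (t : ℝ) :
    charFun (Measure.map (fun x : ι → ℝ => ∑ i, x i) (Measure.pi μ)) t =
      ∏ i, charFun (μ i) t := by
  simp only [charFun_apply_real]
  rw [integral_map (by fun_prop) (by fun_prop), ← integral_fintype_prod_eq_prod]
  simp [← Complex.exp_sum, Finset.mul_sum, Finset.sum_mul]

theorem stmt_8 (m : ℕ) (hm : 2 ≤ m) (zv : Fin m → ℝ) (hz : ∀ i, 0 < zv i) :
    Measure.map (fun x : Fin m → ℝ => ∑ i, x i) (Measure.pi fun i => gigMeasure (zv i)) =
      Measure.conv (gigMeasure (∑ i, zv i)) (gammaMeasure (((m : ℝ) - 1) / 2) (1 / 2)) := by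
  have : Nonempty (Fin m) := ⟨⟨0, by omega⟩⟩
  have hm' : (2 : ℝ) ≤ m := by exact_mod_cast hm
  have hZ : 0 < ∑ i, zv i := Finset.sum_pos (fun i _ => hz i) Finset.univ_nonempty
  have hα : 0 < ((m : ℝ) - 1) / 2 := by linarith
  have hr : (0 : ℝ) < 1 / 2 := by norm_num
  have (i : Fin m) : IsFiniteMeasure (gigMeasure (zv i)) := isFiniteMeasure_gigMeasure (hz i)
  have : IsFiniteMeasure (gigMeasure (∑ i, zv i)) := isFiniteMeasure_gigMeasure hZ
  have : IsFiniteMeasure (gammaMeasure (((m : ℝ) - 1) / 2) (1 / 2)) :=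
    isFiniteMeasure_gammaMeasure hα hr
  have hF : AnalyticOnNhd ℂ
      (fun w => ∏ i, ProbabilityTheory.complexMGF id (gigMeasure (zv i)) w)
      {w | w.re < 1 / 2} :=
    Finset.univ.analyticOnNhd_fun_prod fun i _ =>
      analyticOnNhd_complexMGF_id_of_integrable fun _ ht => (mgf_gigMeasure (hz i) ht).1
  have hG : AnalyticOnNhd ℂ
      (fun w => ProbabilityTheory.complexMGF id (gigMeasure (∑ i, zv i)) w *
        ProbabilityTheory.complexMGF id (gammaMeasure (((m : ℝ) - 1) / 2) (1 / 2)) w)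
      {w | w.re < 1 / 2} :=
    (analyticOnNhd_complexMGF_id_of_integrable fun _ ht => (mgf_gigMeasure hZ ht).1).mul
      (analyticOnNhd_complexMGF_id_of_integrable fun _ ht => (mgf_gammaMeasure hα hr ht).1)
  refine Measure.ext_of_charFun (funext fun t => ?_)
  rw [charFun_map_sum_pi, charFun_conv]
  simp only [← ProbabilityTheory.complexMGF_id_mul_I]
  refine eqOn_re_lt_of_eq_ofReal hF hG (fun s hs => ?_) (by simp)
  simp only [ProbabilityTheory.complexMGF_ofReal, ← Complex.ofReal_prod, ← Complex.ofReal_mul]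
  congr 1
  rw [(mgf_gammaMeasure hα hr hs).2, (mgf_gigMeasure hZ hs).2,
    Finset.prod_congr rfl fun i _ => (mgf_gigMeasure (hz i) hs).2]
  have hpos : 0 < 1 - 2 * s := by linarith
  have ha : 0 < √(1 - 2 * s) := Real.sqrt_pos.2 hpos
  have hgamma : (1 / 2 / (1 / 2 - s)) ^ (((m : ℝ) - 1) / 2) = (√(1 - 2 * s) ^ (m - 1))⁻¹ := by
    rw [show 1 / 2 / (1 / 2 - s) = (1 - 2 * s)⁻¹ by
      rw [show 1 - 2 * s = 2 * (1 / 2 - s) by ring, mul_inv]; ring,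
      Real.inv_rpow hpos.le, Real.sqrt_eq_rpow, ← Real.rpow_natCast, ← Real.rpow_mul hpos.le,
      Nat.cast_sub (by omega)]
    congr 2
    push_cast
    ring
  rw [hgamma, Finset.prod_div_distrib, ← Real.exp_sum, ← Finset.sum_mul, Finset.prod_const,
    Finset.card_univ, Fintype.card_fin, ← div_eq_mul_inv, div_div, mul_pow_sub_one (by omega)]
end

section
/- For every integer m ≥ 2, every n ∈ ℕ, and all complex numbers z₁, …, z_m with z = z₁ + ⋯ + z_m, the following identity holds: ∑_{k₁+⋯+k_m = n} ∏_{i=1}^{m} L_{kᵢ}^{(-2kᵢ-1)}(zᵢ) = ∑_{k=0}^{n} (-4)^{n-k} · ((m-1)/2)_{n-k} / (n-k)! · L_k^{(-2k-1)}(z), where the sum on the left is over all m-tuples (k₁, …, k_m) of nonnegative integers summing to n. -/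
/-- The Pochhammer symbol (rising factorial) `(a)_j = a (a+1) ⋯ (a+j-1)`. -/
noncomputable def poch (a : ℂ) (j : ℕ) : ℂ := ∏ i ∈ Finset.range j, (a + i)

/-- The generalized Laguerre polynomial
`L_n^{(α)}(x) = ∑_{k=0}^n [(α+k+1)_{n-k} / ((n-k)! k!)] (-x)^k`. -/
noncomputable def laguerre (α : ℂ) (n : ℕ) (x : ℂ) : ℂ :=
  ∑ k ∈ Finset.range (n + 1),
    poch (α + k + 1) (n - k) / ((Nat.factorial (n - k) : ℂ) * (Nat.factorial k : ℂ)) * (-x) ^ k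

open PowerSeries

/-- The power series `(1 + 4X) ^ (-a)`. -/
noncomputable def oneAddFourXPowNeg (a : ℂ) : ℂ⟦X⟧ :=
  rescale (4 : ℂ) (binomialSeries ℂ (-a))

/-- The power series whose `n`-th coefficient is `L_n^{(-2n-1)}(z)`. -/
noncomputable def laguerreSeries (z : ℂ) : ℂ⟦X⟧ :=
  mk fun n ↦ laguerre (-(2 * (n : ℂ)) - 1) n z

/-- The power series `∑_{n ≥ k} (-1)^n C(2n-k, n) X^n`. -/
noncomputable def chooseSeries (k : ℕ) : ℂ⟦X⟧ :=
  mk fun n ↦ if k ≤ n then (-1) ^ n * ((2 * n - k).choose n : ℂ) else 0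

/-- The power series `(1 - √(1 + 4X)) / 2`. -/
noncomputable def halfOneSubSqrt : ℂ⟦X⟧ :=
  C (1 / 2 : ℂ) * (1 - oneAddFourXPowNeg (-1 / 2))

section Pochhammer

lemma descPochhammer_smeval_eq_prod (a : ℂ) (j : ℕ) :
    (descPochhammer ℤ j).smeval a = ∏ i ∈ Finset.range j, (a - i) := by
  induction j with
  | zero => simp
  | succ j ih =>
    rw [descPochhammer_succ_right, Polynomial.smeval_mul, ih, Finset.prod_range_succ,
      Polynomial.smeval_sub, Polynomial.smeval_X, Polynomial.smeval_natCast]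
    simp

lemma factorial_mul_choose_neg (a : ℂ) (j : ℕ) :
    (j.factorial : ℂ) * Ring.choose (-a) j = (-1) ^ j * poch a j := by
  have h : (j.factorial : ℂ) ≠ 0 := by exact_mod_cast j.factorial_ne_zero
  rw [Ring.choose_eq_smul, smul_eq_mul, mul_inv_cancel_left₀ h, poch,
    descPochhammer_smeval_eq_prod]
  rw [← Finset.card_range j, ← Finset.prod_const, Finset.card_range, ← Finset.prod_mul_distrib]
  exact Finset.prod_congr rfl fun i _ ↦ by ring

lemma poch_neg_natCast (N j : ℕ) : poch (-(N : ℂ)) j = (-1) ^ j * (N.descFactorial j : ℂ) := by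
  have h := factorial_mul_choose_neg (-(N : ℂ)) j
  rw [neg_neg, Ring.choose_natCast, ← Nat.cast_mul,
    ← Nat.descFactorial_eq_factorial_mul_choose] at h
  rw [h, ← mul_assoc, ← mul_pow]
  simp

lemma laguerre_term (n k : ℕ) (hk : k ≤ n) (z : ℂ) :
    poch (-(2 * (n : ℂ)) - 1 + k + 1) (n - k) /
      ((Nat.factorial (n - k) : ℂ) * (Nat.factorial k : ℂ)) * (-z) ^ k =
      z ^ k / k.factorial * ((-1) ^ n * ((2 * n - k).choose n : ℂ)) := by
  have hN : (-(2 * (n : ℂ)) - 1 + k + 1) = -((2 * n - k : ℕ) : ℂ) := by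
    rw [Nat.cast_sub (by lia)]
    push_cast
    ring
  have h1 : ((n - k).factorial : ℂ) ≠ 0 := by exact_mod_cast (n - k).factorial_ne_zero
  have h2 : (k.factorial : ℂ) ≠ 0 := by exact_mod_cast k.factorial_ne_zero
  rw [hN, poch_neg_natCast, Nat.descFactorial_eq_factorial_mul_choose,
    Nat.choose_symm_of_eq_add (show 2 * n - k = (n - k) + n by lia), neg_pow z,
    show (-1 : ℂ) ^ n = (-1) ^ (n - k) * (-1) ^ k by rw [← pow_add, Nat.sub_add_cancel hk]]
  push_cast
  field_simp

end Pochhammer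

section OneAddFourXPowNeg

lemma oneAddFourXPowNeg_add (a b : ℂ) :
    oneAddFourXPowNeg (a + b) = oneAddFourXPowNeg a * oneAddFourXPowNeg b := by
  simp only [oneAddFourXPowNeg, neg_add, binomialSeries_add, map_mul]

lemma oneAddFourXPowNeg_zero : oneAddFourXPowNeg 0 = 1 := by
  simp [oneAddFourXPowNeg]

lemma oneAddFourXPowNeg_neg_one : oneAddFourXPowNeg (-1) = 1 + C (4 : ℂ) * X := by
  have h := binomialSeries_nat (R := ℂ) (A := ℂ) 1
  rw [Nat.cast_one, pow_one] at h
  rw [oneAddFourXPowNeg, neg_neg, h, map_add, map_one, rescale_X]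

lemma oneAddFourXPowNeg_pow (a : ℂ) (m : ℕ) :
    oneAddFourXPowNeg a ^ m = oneAddFourXPowNeg (m * a) := by
  induction m with
  | zero => simp [oneAddFourXPowNeg_zero]
  | succ m ih => rw [pow_succ, ih, ← oneAddFourXPowNeg_add]; congr 1; push_cast; ring

lemma coeff_oneAddFourXPowNeg (a : ℂ) (j : ℕ) :
    coeff j (oneAddFourXPowNeg a) = (-4) ^ j * poch a j / (j.factorial : ℂ) := by
  have h : (j.factorial : ℂ) ≠ 0 := by exact_mod_cast j.factorial_ne_zero
  rw [oneAddFourXPowNeg, coeff_rescale, binomialSeries_coeff, smul_eq_mul, mul_one,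
    eq_div_iff h, mul_assoc, mul_comm (Ring.choose _ _), factorial_mul_choose_neg, ← mul_assoc,
    ← mul_pow]
  norm_num

end OneAddFourXPowNeg

section ChooseSeries

lemma halfOneSubSqrt_sq : halfOneSubSqrt ^ 2 = halfOneSubSqrt + X := by
  have h : oneAddFourXPowNeg (-1 / 2) ^ 2 = 1 + C (4 : ℂ) * X := by
    rw [oneAddFourXPowNeg_pow, ← oneAddFourXPowNeg_neg_one]
    norm_num
  have h4 : C (1 / 2 : ℂ) ^ 2 * C (4 : ℂ) = 1 := by
    rw [← map_pow, ← map_mul, ← map_one C]; norm_num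
  have h2 : 2 * C (1 / 2 : ℂ) = 1 := by
    rw [← map_ofNat C 2, ← map_mul, ← map_one C]; norm_num
  rw [halfOneSubSqrt]
  linear_combination C (1 / 2 : ℂ) ^ 2 * h + X * h4 +
    (C (1 / 2 : ℂ) - C (1 / 2 : ℂ) * oneAddFourXPowNeg (-1 / 2)) * h2

lemma constantCoeff_halfOneSubSqrt : constantCoeff halfOneSubSqrt = 0 := by
  simp [halfOneSubSqrt, oneAddFourXPowNeg, ← coeff_zero_eq_constantCoeff_apply,
    -coeff_zero_eq_constantCoeff, coeff_rescale]

lemma poch_half (n : ℕ) :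
    (-4 : ℂ) ^ n * poch (1 / 2) n / (n.factorial : ℂ) = (-1) ^ n * (n.centralBinom : ℂ) := by
  induction n with
  | zero => simp [poch]
  | succ n ih =>
    have h : (n.factorial : ℂ) ≠ 0 := by exact_mod_cast n.factorial_ne_zero
    have h1 : (n + 1 : ℂ) ≠ 0 := by exact_mod_cast n.succ_ne_zero
    have hc : (n + 1 : ℂ) * ((n + 1).centralBinom : ℂ) = 2 * (2 * n + 1) * n.centralBinom := by
      exact_mod_cast Nat.succ_mul_centralBinom_succ n
    have hp : poch (1 / 2) (n + 1) = poch (1 / 2) n * (1 / 2 + n) := by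
      rw [poch, Finset.prod_range_succ, poch]
    apply mul_left_cancel₀ h1
    rw [div_eq_iff h] at ih
    rw [hp, Nat.factorial_succ]
    push_cast
    field_simp
    linear_combination (-4) * (1 + 2 * n) * ih + 2 * (-1) ^ n * n.factorial * hc

lemma chooseSeries_zero : chooseSeries 0 = oneAddFourXPowNeg (1 / 2) := by
  ext n
  rw [coeff_oneAddFourXPowNeg, poch_half]
  simp [chooseSeries, Nat.centralBinom]

lemma chooseSeries_one : chooseSeries 1 = oneAddFourXPowNeg (1 / 2) * halfOneSubSqrt := by
  have h : oneAddFourXPowNeg (1 / 2) * halfOneSubSqrt =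
      C (1 / 2 : ℂ) * (chooseSeries 0 - 1) := by
    rw [halfOneSubSqrt, mul_left_comm, mul_sub, ← oneAddFourXPowNeg_add, chooseSeries_zero]
    norm_num [oneAddFourXPowNeg_zero]
  rw [h]
  ext n
  cases n with
  | zero => simp [chooseSeries]
  | succ n =>
    have hc : ((2 * (n + 1)).choose (n + 1) : ℂ) = 2 * ((2 * (n + 1) - 1).choose (n + 1) : ℂ) := by
      have h' : (2 * n + 1).choose n = (2 * n + 1).choose (n + 1) :=
        Nat.choose_symm_of_eq_add (by lia)
      rw [show 2 * (n + 1) = 2 * n + 1 + 1 by ring, Nat.choose_succ_succ', h']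
      push_cast
      ring
    rw [coeff_C_mul, map_sub, coeff_one]
    simp only [chooseSeries, coeff_mk, Nat.sub_zero, hc]
    simp
    ring

lemma chooseSeries_add_two (k : ℕ) :
    chooseSeries (k + 2) = chooseSeries (k + 1) + X * chooseSeries k := by
  ext n
  cases n with
  | zero => simp [chooseSeries]
  | succ n =>
    rw [map_add, coeff_succ_X_mul]
    simp only [chooseSeries, coeff_mk]
    rcases lt_trichotomy n k with h | h | h
    · simp [show ¬ k ≤ n by lia, show ¬ k + 2 ≤ n + 1 by lia, show ¬ k + 1 ≤ n + 1 by lia]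
    · subst h
      simp [show 2 * (n + 1) - (n + 1) = n + 1 by lia, show 2 * n - n = n by lia, pow_succ]
    · rw [if_pos (by lia), if_pos (by lia), if_pos (by lia),
        show 2 * (n + 1) - (k + 1) = (2 * n - k) + 1 by lia,
        show 2 * (n + 1) - (k + 2) = 2 * n - k by lia, Nat.choose_succ_succ']
      push_cast
      ring

lemma chooseSeries_eq (k : ℕ) :
    chooseSeries k = oneAddFourXPowNeg (1 / 2) * halfOneSubSqrt ^ k := by
  induction k using Nat.twoStepInduction with
  | zero => rw [chooseSeries_zero, pow_zero, mul_one]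
  | one => rw [chooseSeries_one, pow_one]
  | more k h0 h1 =>
    rw [chooseSeries_add_two, h0, h1]
    linear_combination -oneAddFourXPowNeg (1 / 2) * halfOneSubSqrt ^ k * halfOneSubSqrt_sq

end ChooseSeries

section LaguerreSeries

lemma coeff_mul_subst {R : Type*} [CommRing R] (P f : R⟦X⟧) {u : R⟦X⟧}
    (hu : constantCoeff u = 0) (n : ℕ) :
    coeff n (P * f.subst u) = ∑ k ∈ Finset.range (n + 1), coeff k f * coeff n (P * u ^ k) := by
  have hdvd (k : ℕ) : (X : R⟦X⟧) ^ k ∣ u ^ k := pow_dvd_pow_of_dvd (X_dvd_iff.mpr hu) k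
  have hsub (j : ℕ) (hj : j ≤ n) :
      coeff j (f.subst u) = ∑ k ∈ Finset.range (n + 1), coeff k f * coeff j (u ^ k) := by
    rw [coeff_subst' (HasSubst.of_constantCoeff_zero' hu)]
    refine finsum_eq_sum_of_support_subset _ fun k hk ↦ ?_
    by_contra hk'
    refine hk ?_
    simp only [Finset.coe_range, Set.mem_Iio, not_lt] at hk'
    simp only [X_pow_dvd_iff.mp (hdvd k) j (by lia), smul_zero]
  simp only [coeff_mul, Finset.mul_sum]
  rw [Finset.sum_comm]
  refine Finset.sum_congr rfl fun p hp ↦ ?_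
  rw [hsub p.2 (by rw [Finset.HasAntidiagonal.mem_antidiagonal] at hp; lia), Finset.mul_sum]
  exact Finset.sum_congr rfl fun k _ ↦ by ring

lemma laguerreSeries_eq (z : ℂ) :
    laguerreSeries z =
      oneAddFourXPowNeg (1 / 2) * (rescale z (exp ℂ)).subst halfOneSubSqrt := by
  ext n
  rw [coeff_mul_subst _ _ constantCoeff_halfOneSubSqrt, laguerreSeries, coeff_mk, laguerre]
  refine Finset.sum_congr rfl fun k hk ↦ ?_
  have hk' : k ≤ n := Nat.lt_succ_iff.mp (Finset.mem_range.mp hk)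
  rw [laguerre_term n k hk', ← chooseSeries_eq, chooseSeries, coeff_mk, if_pos hk', coeff_rescale,
    coeff_exp]
  simp [div_eq_mul_inv]

lemma prod_rescale_exp {ι : Type*} (s : Finset ι) (z : ι → ℂ) :
    ∏ i ∈ s, rescale (z i) (exp ℂ) = rescale (∑ i ∈ s, z i) (exp ℂ) := by
  classical
  induction s using Finset.induction_on with
  | empty => simp
  | insert i s hi ih =>
    rw [Finset.prod_insert hi, Finset.sum_insert hi, ih, exp_mul_exp_eq_exp_add]

lemma prod_laguerreSeries {m : ℕ} (z : Fin m → ℂ) :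
    ∏ i, laguerreSeries (z i) =
      oneAddFourXPowNeg (((m : ℂ) - 1) / 2) * laguerreSeries (∑ i, z i) := by
  have hu : HasSubst halfOneSubSqrt := HasSubst.of_constantCoeff_zero' constantCoeff_halfOneSubSqrt
  simp only [laguerreSeries_eq, Finset.prod_mul_distrib, Finset.prod_const, Finset.card_univ,
    Fintype.card_fin, ← coe_substAlgHom hu, ← map_prod, prod_rescale_exp]
  rw [oneAddFourXPowNeg_pow, ← mul_assoc, ← oneAddFourXPowNeg_add]
  congr 2
  ring

end LaguerreSeries

lemma coeff_prod_fin {R : Type*} [CommSemiring R] {m : ℕ} (f : Fin m → R⟦X⟧) (n : ℕ) :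
    coeff n (∏ i, f i) =
      ∑ k ∈ Finset.Nat.antidiagonalTuple m n, ∏ i, coeff (k i) (f i) := by
  rw [coeff_prod]
  refine Finset.sum_bij (fun l _ ↦ ⇑l) ?_ ?_ ?_ fun _ _ ↦ rfl
  · intro l hl
    rw [Finset.Nat.mem_antidiagonalTuple]
    exact (Finset.mem_finsuppAntidiag.mp hl).1
  · exact fun _ _ _ _ h ↦ DFunLike.coe_injective h
  · intro k hk
    rw [Finset.Nat.mem_antidiagonalTuple] at hk
    exact ⟨Finsupp.equivFunOnFinite.symm k, by simp [Finset.mem_finsuppAntidiag, hk], rfl⟩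

theorem stmt_13 (m : ℕ) (hm : 2 ≤ m) (n : ℕ) (zv : Fin m → ℂ) :
    ∑ k ∈ Finset.Nat.antidiagonalTuple m n,
      ∏ i, laguerre (-(2 * (k i : ℂ)) - 1) (k i) (zv i) =
    ∑ k ∈ Finset.range (n + 1),
      (-4 : ℂ) ^ (n - k) * poch (((m : ℂ) - 1) / 2) (n - k) / (Nat.factorial (n - k) : ℂ) *
        laguerre (-(2 * (k : ℂ)) - 1) k (∑ i, zv i) := by
  have h := congrArg (coeff n) (prod_laguerreSeries zv)
  rw [coeff_prod_fin, mul_comm, coeff_mul,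
    Finset.Nat.sum_antidiagonal_eq_sum_range_succ_mk] at h
  simp only [coeff_oneAddFourXPowNeg, laguerreSeries, coeff_mk] at h
  rw [h]
  exact Finset.sum_congr rfl fun k _ ↦ mul_comm _ _
end

section
/- For every integer m ≥ 2, every n ∈ ℕ, and all real z₁, …, z_m > 0 with z = z₁ + ⋯ + z_m, the following identity holds: ∑_{k₁+⋯+k_m = n} ∏_{i=1}^{m} [zᵢ^{kᵢ+1/2} · K_{kᵢ-1/2}(zᵢ) / kᵢ!] = (2/π)^{(1-m)/2} · z^{n+1/2} · K_{n-1/2}(z) / n!, where the sum on the left is over all m-tuples (k₁, …, k_m) of nonnegative integers summing to n. -/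
/-- The modified Bessel function of the second kind,
`K_ν(z) = (1/2) ∫_0^∞ t^{ν-1} exp(-z(t + 1/t)/2) dt`. -/
noncomputable def besselK (ν z : ℝ) : ℝ :=
  (1 / 2) * ∫ t in Set.Ioi (0 : ℝ), t ^ (ν - 1) * Real.exp (-z * (t + 1 / t) / 2)

open PowerSeries in
theorem exists_sq_eq_one_sub_two_X :
    ∃ s : PowerSeries ℝ, s * s = 1 - 2 * X ∧ constantCoeff s = 1 := by
  refine ⟨rescale (-2) (binomialSeries ℝ (1 / 2 : ℝ)), ?_, ?_⟩
  · rw [← map_mul, ← binomialSeries_add]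
    have h := binomialSeries_nat (R := ℝ) (A := ℝ) 1
    rw [add_halves, show (1 : ℝ) = ((1 : ℕ) : ℝ) by simp, h]
    ext n
    rw [coeff_rescale, ← map_ofNat (C (R := ℝ)) 2, map_sub, coeff_C_mul]
    rcases n with _ | _ | n <;> simp [coeff_X, coeff_one]
  · rw [← coeff_zero_eq_constantCoeff_apply, coeff_rescale]
    simp

open PowerSeries in
theorem eq_zero_of_mul_derivative_eq {s D : PowerSeries ℝ} (w : ℝ) (hs : constantCoeff s = 1)
    (hD : s * derivative ℝ D = C w * D) (h0 : constantCoeff D = 0) : D = 0 := by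
  ext n
  induction n using Nat.strong_induction_on with
  | _ n ih =>
    rcases n with _ | n
    · simpa using h0
    · have h := congrArg (coeff n) hD
      rw [coeff_mul, coeff_C_mul, ih n (by omega),
        Finset.sum_eq_single_of_mem (0, n) (by simp)] at h
      · simp only [coeff_zero_eq_constantCoeff, hs, coeff_derivative, map_zero, one_mul, mul_zero]
          at h
        rcases mul_eq_zero.1 h with h | h
        · simpa using h
        · exact absurd h (by positivity)
      · rintro ⟨i, j⟩ hij hne
        rw [Finset.HasAntidiagonal.mem_antidiagonal] at hij
        have : j + 1 < n + 1 := by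
          by_contra hj
          exact hne (by ext <;> simp only <;> simp at hij <;> omega)
        simp [coeff_derivative, ih (j + 1) this]

/-- The coefficients of the exponential generating function `exp (-z * √(1 - 2 * x))`. -/
noncomputable def expSqrtCoeff (z : ℝ) : ℕ → ℝ
  | 0 => Real.exp (-z)
  | 1 => z * Real.exp (-z)
  | k + 2 => (2 * k + 1) * expSqrtCoeff z (k + 1) + z ^ 2 * expSqrtCoeff z k

/-- The formal power series `exp (-z * √(1 - 2 * X))`. -/
noncomputable def expSqrtSeries (z : ℝ) : PowerSeries ℝ :=
  PowerSeries.mk fun k => expSqrtCoeff z k / (k.factorial : ℝ)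

open PowerSeries in
theorem mul_derivative_expSqrtSeries {s : PowerSeries ℝ} (hs : s * s = 1 - 2 * X)
    (hs0 : constantCoeff s = 1) (z : ℝ) :
    s * derivative ℝ (expSqrtSeries z) = C z * expSqrtSeries z := by
  have hs' : s * derivative ℝ s = -1 := by
    have h := congrArg (derivative ℝ) hs
    rw [Derivation.leibniz, map_sub, Derivation.leibniz, derivative_X] at h
    simp only [smul_eq_mul] at h
    have h2 : derivative ℝ (2 : PowerSeries ℝ) = 0 := by
      rw [← map_ofNat (C (R := ℝ)) 2, derivative_C]
    have h1 : derivative ℝ (1 : PowerSeries ℝ) = 0 := by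
      rw [← map_one (C (R := ℝ)), derivative_C]
    rw [h1, h2] at h
    have : (2 : PowerSeries ℝ) * (s * derivative ℝ s) = 2 * (-1) := by linear_combination h
    exact mul_left_cancel₀ (by rw [← map_ofNat (C (R := ℝ)) 2]; simp) this
  set F := expSqrtSeries z with hF
  have hode : (1 - 2 * X) * derivative ℝ (derivative ℝ F) = derivative ℝ F + C (z ^ 2) * F := by
    ext n
    rw [sub_mul, one_mul, mul_assoc, ← map_ofNat (C (R := ℝ)) 2, map_sub, map_add, coeff_C_mul,
      coeff_C_mul]
    have hfac (k : ℕ) : (k.factorial : ℝ) ≠ 0 := by positivity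
    rcases n with _ | n
    · simp [coeff_derivative, hF, expSqrtSeries, expSqrtCoeff, coeff_zero_X_mul,
        Nat.factorial]
      ring
    · rw [coeff_succ_X_mul]
      simp only [coeff_derivative, hF, expSqrtSeries, coeff_mk, expSqrtCoeff, Nat.factorial_succ]
      have := hfac n
      push_cast
      field_simp
      ring
  have hH : s * derivative ℝ F - C z * F = 0 := by
    refine eq_zero_of_mul_derivative_eq (-z) hs0 ?_ ?_
    · rw [map_sub, Derivation.leibniz, Derivation.leibniz, derivative_C]
      simp only [smul_eq_mul, map_neg, map_pow] at hode ⊢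
      linear_combination hode + derivative ℝ F * hs' + derivative ℝ (derivative ℝ F) * hs
    · rw [map_sub, map_mul, map_mul, hs0, ← coeff_zero_eq_constantCoeff_apply,
        ← coeff_zero_eq_constantCoeff_apply]
      simp [coeff_derivative, hF, expSqrtSeries, expSqrtCoeff]
  exact sub_eq_zero.1 hH

open PowerSeries in
theorem constantCoeff_expSqrtSeries (z : ℝ) : constantCoeff (expSqrtSeries z) = Real.exp (-z) := by
  simp [← coeff_zero_eq_constantCoeff_apply, expSqrtSeries, expSqrtCoeff]

open PowerSeries in
theorem expSqrtSeries_add (z w : ℝ) :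
    expSqrtSeries (z + w) = expSqrtSeries z * expSqrtSeries w := by
  obtain ⟨s, hs, hs0⟩ := exists_sq_eq_one_sub_two_X
  have hD := mul_derivative_expSqrtSeries hs hs0
  refine sub_eq_zero.1 (eq_zero_of_mul_derivative_eq (z + w) hs0 ?_ ?_)
  · rw [map_sub, Derivation.leibniz]
    have h := hD (z + w)
    simp only [smul_eq_mul, map_add] at h ⊢
    linear_combination h - expSqrtSeries w * hD z - expSqrtSeries z * hD w
  · simp [constantCoeff_expSqrtSeries, Real.exp_add, mul_comm]

open PowerSeries in
theorem expSqrtSeries_zero : expSqrtSeries 0 = 1 := by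
  obtain ⟨s, hs, hs0⟩ := exists_sq_eq_one_sub_two_X
  refine sub_eq_zero.1 (eq_zero_of_mul_derivative_eq 0 hs0 ?_ ?_)
  · rw [map_sub, mul_sub, mul_derivative_expSqrtSeries hs hs0, ← map_one (C (R := ℝ)),
      derivative_C]
    simp
  · simp [constantCoeff_expSqrtSeries]

theorem expSqrtSeries_sum {ι : Type*} (s : Finset ι) (z : ι → ℝ) :
    expSqrtSeries (∑ i ∈ s, z i) = ∏ i ∈ s, expSqrtSeries (z i) := by
  classical
  induction s using Finset.induction_on with
  | empty => simpa using expSqrtSeries_zero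
  | insert a s ha ih => rw [Finset.sum_insert ha, Finset.prod_insert ha, expSqrtSeries_add, ih]

open Finset in
theorem sum_antidiagonalTuple_prod_coeff {R : Type*} [CommSemiring R] (m n : ℕ)
    (f : Fin m → PowerSeries R) :
    ∑ k ∈ Nat.antidiagonalTuple m n, ∏ i, PowerSeries.coeff (k i) (f i) =
      PowerSeries.coeff n (∏ i, f i) := by
  rw [PowerSeries.coeff_prod]
  symm
  refine sum_bij (fun l _ => (l : Fin m → ℕ)) ?_ (fun _ _ _ _ h => DFunLike.coe_injective h) ?_
    (fun _ _ => rfl)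
  · intro l hl
    simpa [Nat.mem_antidiagonalTuple, mem_finsuppAntidiag] using hl
  · intro k hk
    refine ⟨Finsupp.equivFunOnFinite.symm k, ?_, by simp⟩
    simpa [Nat.mem_antidiagonalTuple, mem_finsuppAntidiag] using hk

open Real Set Filter Topology MeasureTheory

theorem exp_neg_mul_add_one_div_le {z t : ℝ} (hz : 0 < z) (ht : 0 < t) :
    exp (-z * (t + 1 / t) / 2) ≤ exp (-(z / 2) * t) := by
  rw [exp_le_exp]
  have : 0 < z * (1 / t) := by positivity
  linarith

theorem integrableOn_rpow_mul_exp_neg_mul_add_one_div {s z : ℝ} (hs : -2 < s) (hz : 0 < z) :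
    IntegrableOn (fun t : ℝ => t ^ s * exp (-z * (t + 1 / t) / 2)) (Ioi 0) := by
  have hg : IntegrableOn (fun t : ℝ => (2 / z) * (t ^ (s + 1) * exp (-(z / 2) * t ^ (1 : ℝ))))
      (Ioi 0) :=
    (integrableOn_rpow_mul_exp_neg_mul_rpow (by linarith) one_pos (by positivity)).const_mul _
  refine Integrable.mono' hg ?_ ?_
  · exact (by fun_prop : Measurable fun t : ℝ => t ^ s * exp (-z * (t + 1 / t) / 2)
      ).aestronglyMeasurable
  · refine (ae_restrict_iff' measurableSet_Ioi).2 (ae_of_all _ fun t (ht : 0 < t) => ?_)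
    rw [norm_of_nonneg (by positivity), rpow_add_one ht.ne', rpow_one,
      show -z * (t + 1 / t) / 2 = -(z / (2 * t)) + -(z / 2) * t by field_simp; ring, exp_add]
    have h1 : exp (-(z / (2 * t))) ≤ 2 / z * t := by
      rw [exp_neg, inv_le_comm₀ (exp_pos _) (by positivity)]
      refine le_trans (le_of_eq ?_) ((le_add_of_nonneg_right zero_le_one).trans (add_one_le_exp _))
      field_simp
    calc t ^ s * (exp (-(z / (2 * t))) * exp (-(z / 2) * t))
        ≤ t ^ s * (2 / z * t * exp (-(z / 2) * t)) := by gcongr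
      _ = _ := by ring

theorem besselK_add_one {ν z : ℝ} (hν : 0 < ν) (hz : 0 < z) :
    besselK (ν + 1) z = besselK (ν - 1) z + 2 * ν / z * besselK ν z := by
  have hi (s : ℝ) (hs : -2 < s) := integrableOn_rpow_mul_exp_neg_mul_add_one_div hs hz
  have h1 := hi (ν + 1 - 1) (by linarith)
  have h2 := hi (ν - 1) (by linarith)
  have h3 := hi (ν - 1 - 1) (by linarith)
  have hle (t : ℝ) (ht : 0 < t) := exp_neg_mul_add_one_div_le hz ht
  have key : ∫ t in Ioi (0 : ℝ), (ν * (t ^ (ν - 1) * exp (-z * (t + 1 / t) / 2))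
      - z / 2 * (t ^ (ν + 1 - 1) * exp (-z * (t + 1 / t) / 2)))
      + z / 2 * (t ^ (ν - 1 - 1) * exp (-z * (t + 1 / t) / 2)) =
      0 - (0 : ℝ) ^ ν * exp (-z * (0 + 1 / 0) / 2) := by
    refine integral_Ioi_of_hasDerivAt_of_tendsto
      (f := fun t : ℝ => t ^ ν * exp (-z * (t + 1 / t) / 2)) ?_ ?_ ?_ ?_
    · have h0 : Tendsto (fun t : ℝ => t ^ ν) (𝓝[Ici 0] 0) (𝓝 0) := by
        have := (continuousAt_rpow_const 0 ν (Or.inr hν.le)).tendsto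
        rw [zero_rpow hν.ne'] at this
        exact this.mono_left nhdsWithin_le_nhds
      rw [ContinuousWithinAt, zero_rpow hν.ne', zero_mul]
      refine squeeze_zero' ?_ ?_ h0
      · filter_upwards [self_mem_nhdsWithin] with t (ht : 0 ≤ t) using by positivity
      · filter_upwards [self_mem_nhdsWithin] with t (ht : 0 ≤ t)
        refine mul_le_of_le_one_right (by positivity) (exp_le_one_iff.2 ?_)
        have : 0 ≤ z * (t + 1 / t) := by positivity
        linarith
    · intro t (ht : 0 < t)
      have hd : HasDerivAt (fun t : ℝ => -z * (t + 1 / t) / 2) (-z * (1 + -(t ^ 2)⁻¹) / 2) t := by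
        simp only [one_div]
        exact (((hasDerivAt_id t).add (hasDerivAt_inv ht.ne')).const_mul (-z)).div_const 2
      refine ((hasDerivAt_rpow_const (p := ν) (Or.inl ht.ne')).mul hd.exp).congr_deriv ?_
      rw [rpow_sub_one ht.ne' (ν - 1), rpow_sub_one ht.ne' ν, add_sub_cancel_right]
      field_simp
      ring
    · exact ((h2.const_mul ν).sub (h1.const_mul (z / 2))).add (h3.const_mul (z / 2))
    · refine squeeze_zero' ?_ ?_
        (tendsto_rpow_mul_exp_neg_mul_atTop_nhds_zero ν (z / 2) (by positivity))
      · filter_upwards [eventually_gt_atTop 0] with t ht using by positivity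
      · filter_upwards [eventually_gt_atTop 0] with t ht
        exact mul_le_mul_of_nonneg_left (hle t ht) (by positivity)
  rw [zero_rpow hν.ne', integral_add (f := fun t : ℝ => ν * (t ^ (ν - 1) *
    exp (-z * (t + 1 / t) / 2)) - z / 2 * (t ^ (ν + 1 - 1) * exp (-z * (t + 1 / t) / 2)))
    ((h2.const_mul ν).sub (h1.const_mul (z / 2))) (h3.const_mul (z / 2)), integral_sub (h2.const_mul ν) (h1.const_mul (z / 2)),
    integral_const_mul, integral_const_mul, integral_const_mul] at key
  simp only [besselK]
  generalize (∫ t in Ioi (0 : ℝ), t ^ (ν + 1 - 1) * exp (-z * (t + 1 / t) / 2)) = A at key ⊢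
  generalize (∫ t in Ioi (0 : ℝ), t ^ (ν - 1 - 1) * exp (-z * (t + 1 / t) / 2)) = B at key ⊢
  generalize (∫ t in Ioi (0 : ℝ), t ^ (ν - 1) * exp (-z * (t + 1 / t) / 2)) = D at key ⊢
  field_simp
  linarith

theorem besselK_neg (ν z : ℝ) : besselK (-ν) z = besselK ν z := by
  rw [besselK, besselK, ← integral_comp_rpow_Ioi _ (neg_ne_zero.2 one_ne_zero)]
  congr 1
  refine setIntegral_congr_fun measurableSet_Ioi fun t (ht : 0 < t) => ?_
  simp only [abs_neg, abs_one, one_mul, smul_eq_mul, rpow_neg_one]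
  rw [← mul_assoc, inv_rpow ht.le, ← rpow_neg ht.le, ← rpow_add ht, one_div, one_div, inv_inv,
    add_comm t⁻¹]
  congr 2
  ring

theorem besselK_one_half {z : ℝ} (hz : 0 < z) :
    besselK (1 / 2) z = √(π / (2 * z)) * exp (-z) := by
  set φ : ℝ → ℝ := fun t => √t - (√t)⁻¹ with hφ
  have hd : ∀ t ∈ Ioi (0 : ℝ), HasDerivWithinAt φ
      (1 / (2 * √t) - -(1 / (2 * √t)) / (√t) ^ 2) (Ioi 0) t := fun t (ht : 0 < t) =>
    ((hasDerivAt_sqrt ht.ne').sub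
      ((hasDerivAt_sqrt ht.ne').inv (sqrt_ne_zero'.2 ht))).hasDerivWithinAt
  have hinj : InjOn φ (Ioi 0) := by
    refine StrictMonoOn.injOn fun a (ha : 0 < a) b (hb : 0 < b) hab => ?_
    have h : √a < √b := sqrt_lt_sqrt ha.le hab
    have h' : (√b)⁻¹ < (√a)⁻¹ := (inv_lt_inv₀ (sqrt_pos.2 hb) (sqrt_pos.2 ha)).2 h
    simp only [hφ]
    linarith
  have himg : φ '' Ioi 0 = univ := by
    refine eq_univ_of_forall fun v => ?_
    have hlt : |v| < √(v ^ 2 + 4) := by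
      rw [← sqrt_sq_eq_abs]
      exact sqrt_lt_sqrt (sq_nonneg v) (by linarith)
    have hu : 0 < (v + √(v ^ 2 + 4)) / 2 := by linarith [neg_abs_le v]
    refine ⟨((v + √(v ^ 2 + 4)) / 2) ^ 2, pow_pos hu 2, ?_⟩
    simp only [hφ, sqrt_sq hu.le]
    have := sq_sqrt (show 0 ≤ v ^ 2 + 4 by positivity)
    have hne : v + √(v ^ 2 + 4) ≠ 0 := by linarith
    field_simp
    linarith
  have hcov := integral_image_eq_integral_abs_deriv_smul measurableSet_Ioi hd hinj
    (fun v => exp (-(z / 2) * v ^ 2))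
  rw [himg, setIntegral_univ, integral_gaussian] at hcov
  have hi (s : ℝ) (hs : -2 < s) := integrableOn_rpow_mul_exp_neg_mul_add_one_div hs hz
  have hsum : ∫ t in Ioi (0 : ℝ), |1 / (2 * √t) - -(1 / (2 * √t)) / (√t) ^ 2| •
      exp (-(z / 2) * φ t ^ 2) = exp z * (besselK (1 / 2) z + besselK (-(1 / 2)) z) := by
    rw [besselK, besselK, ← mul_add, ← integral_add (hi _ (by norm_num)) (hi _ (by norm_num)),
      ← integral_const_mul, ← integral_const_mul]
    refine setIntegral_congr_fun measurableSet_Ioi fun t (ht : 0 < t) => ?_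
    have hs : 0 < √t := sqrt_pos.2 ht
    have hst : √t ^ 2 = t := sq_sqrt ht.le
    have e1 : t ^ (1 / 2 - 1 : ℝ) = 1 / √t := by
      rw [rpow_sub_one ht.ne', ← sqrt_eq_rpow]
      nth_rewrite 2 [← hst]
      field_simp
    have e2 : t ^ (-(1 / 2) - 1 : ℝ) = 1 / (√t * t) := by
      rw [rpow_sub_one ht.ne', rpow_neg ht.le, ← sqrt_eq_rpow]
      field_simp
    have e3 : exp (-(z / 2) * φ t ^ 2) = exp z * exp (-z * (t + 1 / t) / 2) := by
      rw [← exp_add]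
      congr 1
      have : φ t ^ 2 = t - 2 + 1 / t := by
        simp only [hφ]
        rw [sub_sq, inv_pow, hst, mul_assoc, mul_inv_cancel₀ hs.ne']
        ring
      rw [this]
      ring
    have e4 : 1 / (2 * √t) - -(1 / (2 * √t)) / (√t) ^ 2 = 1 / 2 * (1 / √t + 1 / (√t * t)) := by
      rw [hst]
      field_simp
      ring
    simp only [smul_eq_mul]
    rw [e4, e3, e1, e2, abs_of_pos (by positivity)]
    ring
  rw [hsum, besselK_neg] at hcov
  have h4 : √(π / (z / 2)) = 2 * √(π / (2 * z)) := by
    rw [show π / (z / 2) = 2 ^ 2 * (π / (2 * z)) by field_simp, sqrt_mul (by positivity),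
      sqrt_sq (by norm_num)]
  rw [h4] at hcov
  rw [exp_neg, ← div_eq_mul_inv, eq_div_iff (exp_pos z).ne']
  linarith

theorem rpow_mul_besselK_eq {z : ℝ} (hz : 0 < z) (k : ℕ) :
    z ^ ((k : ℝ) + 1 / 2) * besselK ((k : ℝ) - 1 / 2) z = √(π / 2) * expSqrtCoeff z k := by
  have hpow (k : ℕ) : z ^ ((k : ℝ) + 1 / 2) = z ^ k * √z := by
    rw [rpow_add hz, rpow_natCast, sqrt_eq_rpow]
  have hhalf : √z * besselK (1 / 2) z = √(π / 2) * exp (-z) := by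
    rw [besselK_one_half hz, ← mul_assoc, ← sqrt_mul hz.le]
    congr 2
    field_simp
  induction k using Nat.twoStepInduction with
  | zero =>
    rw [hpow, Nat.cast_zero, zero_sub, besselK_neg, pow_zero, one_mul, hhalf, expSqrtCoeff]
  | one =>
    rw [hpow, Nat.cast_one, show (1 - 1 / 2 : ℝ) = 1 / 2 by norm_num, pow_one, mul_assoc, hhalf,
      expSqrtCoeff]
    ring
  | more k ih0 ih1 =>
    rw [hpow] at ih0 ih1 ⊢
    have hK := besselK_add_one (show (0 : ℝ) < k + 1 / 2 by positivity) hz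
    rw [show (k : ℝ) + 1 / 2 - 1 = k - 1 / 2 by ring] at hK
    rw [show ((k + 1 : ℕ) : ℝ) - 1 / 2 = k + 1 / 2 by push_cast; ring] at ih1
    rw [show ((k + 2 : ℕ) : ℝ) - 1 / 2 = k + 1 / 2 + 1 by push_cast; ring, hK, expSqrtCoeff]
    have hsplit : z ^ (k + 2) * √z * (besselK (k - 1 / 2) z +
        2 * (k + 1 / 2) / z * besselK (k + 1 / 2) z) =
        z ^ 2 * (z ^ k * √z * besselK (k - 1 / 2) z) +
        (2 * k + 1) * (z ^ (k + 1) * √z * besselK (k + 1 / 2) z) := by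
      field_simp
      ring
    rw [hsplit, ih0, ih1]
    ring

theorem rpow_mul_besselK_div_factorial {z : ℝ} (hz : 0 < z) (k : ℕ) :
    z ^ ((k : ℝ) + 1 / 2) * besselK ((k : ℝ) - 1 / 2) z / (k.factorial : ℝ) =
      √(π / 2) * PowerSeries.coeff k (expSqrtSeries z) := by
  rw [rpow_mul_besselK_eq hz, expSqrtSeries, PowerSeries.coeff_mk, mul_div_assoc]

theorem stmt_16 (m : ℕ) (hm : 2 ≤ m) (n : ℕ) (zv : Fin m → ℝ) (hz : ∀ i, 0 < zv i) :
    ∑ k ∈ Finset.Nat.antidiagonalTuple m n,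
      ∏ i, (zv i) ^ ((k i : ℝ) + 1 / 2) * besselK ((k i : ℝ) - 1 / 2) (zv i) /
        (Nat.factorial (k i) : ℝ) =
    (2 / Real.pi) ^ ((1 - (m : ℝ)) / 2) * (∑ i, zv i) ^ ((n : ℝ) + 1 / 2) *
      besselK ((n : ℝ) - 1 / 2) (∑ i, zv i) / (Nat.factorial n : ℝ) := by
  have hne : (Finset.univ : Finset (Fin m)).Nonempty := ⟨⟨0, by omega⟩, Finset.mem_univ _⟩
  have hsum : 0 < ∑ i, zv i := Finset.sum_pos (fun i _ => hz i) hne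
  have hconst : (2 / π) ^ ((1 - (m : ℝ)) / 2) * √(π / 2) = √(π / 2) ^ m := by
    rw [← inv_div π 2, inv_rpow (by positivity), ← rpow_neg (by positivity), sqrt_eq_rpow,
      ← rpow_add (by positivity), ← rpow_natCast, ← rpow_mul (by positivity)]
    congr 1
    ring
  rw [mul_assoc, mul_div_assoc, rpow_mul_besselK_div_factorial hsum, ← mul_assoc, hconst,
    expSqrtSeries_sum, ← sum_antidiagonalTuple_prod_coeff, Finset.mul_sum]
  refine Finset.sum_congr rfl fun k _ => ?_
  simp_rw [fun i => rpow_mul_besselK_div_factorial (hz i) (k i)]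
  rw [Finset.prod_mul_distrib, Finset.prod_const, Finset.card_univ, Fintype.card_fin]
end
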